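/- arXiv:2209.09847 — 2 statements merged into one kernel-verified Lean document; each statement's English description precedes it below -/
import Mathlib

section
/- Let G be a finite two-player zero-sum game (u_2 = −u_1). If s_1 is a maximin strategy for player 1 and s_2 is a maximin strategy for player 2, then (s_1, s_2) is a Nash equilibrium of the mixed extension of G, i.e., s_1 is a best response to s_2 and s_2 is a best response to s_1. -/
/-- A mixed strategy: nonnegative weights summing to one. -/
def IsMixed {α : Type*} [Fintype α] (s : α → ℝ) : Prop :=
  (∀ a, 0 ≤ s a) ∧ ∑ a, s a = 1

/-- Expected payoff in a two-player game with payoff function `u`. -/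
noncomputable def U {α β : Type*} [Fintype α] [Fintype β]
    (u : α → β → ℝ) (t₁ : α → ℝ) (t₂ : β → ℝ) : ℝ :=
  ∑ a, ∑ b, t₁ a * t₂ b * u a b

/-- `s₁` is a (mixed) best response of player 1 to `t₂`. -/
def IsBR1 {α β : Type*} [Fintype α] [Fintype β]
    (u₁ : α → β → ℝ) (s₁ : α → ℝ) (t₂ : β → ℝ) : Prop :=
  IsMixed s₁ ∧ ∀ t₁, IsMixed t₁ → U u₁ t₁ t₂ ≤ U u₁ s₁ t₂

/-- `s₂` is a (mixed) best response of player 2 to `t₁`. -/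
def IsBR2 {α β : Type*} [Fintype α] [Fintype β]
    (u₂ : α → β → ℝ) (t₁ : α → ℝ) (s₂ : β → ℝ) : Prop :=
  IsMixed s₂ ∧ ∀ t₂, IsMixed t₂ → U u₂ t₁ t₂ ≤ U u₂ t₁ s₂

/-- `s₁` solves player 1's Definition-4 problem: player 1 is rational assuming
player 2 is both rational and correct. -/
def Solves1 {α β : Type*} [Fintype α] [Fintype β]
    (u₁ u₂ : α → β → ℝ) (s₁ : α → ℝ) : Prop :=
  IsMixed s₁ ∧ ∃ t₂, IsBR2 u₂ s₁ t₂ ∧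
    ∀ t₁ t₂', IsMixed t₁ → IsBR2 u₂ t₁ t₂' → U u₁ t₁ t₂' ≤ U u₁ s₁ t₂

/-- `s₂` solves player 2's Definition-4 problem: player 2 is rational assuming
player 1 is both rational and correct. -/
def Solves2 {α β : Type*} [Fintype α] [Fintype β]
    (u₁ u₂ : α → β → ℝ) (s₂ : β → ℝ) : Prop :=
  IsMixed s₂ ∧ ∃ t₁, IsBR1 u₁ t₁ s₂ ∧
    ∀ t₂ t₁', IsMixed t₂ → IsBR1 u₁ t₁' t₂ → U u₂ t₁' t₂ ≤ U u₂ t₁ s₂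

/-- `s₁` is a maximin strategy for player 1. -/
def IsMaximin1 {α β : Type*} [Fintype α] [Fintype β]
    (u₁ : α → β → ℝ) (s₁ : α → ℝ) : Prop :=
  IsMixed s₁ ∧ ∀ t₁, IsMixed t₁ →
    sInf {x | ∃ t₂, IsMixed t₂ ∧ U u₁ t₁ t₂ = x} ≤
      sInf {x | ∃ t₂, IsMixed t₂ ∧ U u₁ s₁ t₂ = x}

/-- `s₂` is a maximin strategy for player 2. -/
def IsMaximin2 {α β : Type*} [Fintype α] [Fintype β]
    (u₂ : α → β → ℝ) (s₂ : β → ℝ) : Prop :=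
  IsMixed s₂ ∧ ∀ t₂, IsMixed t₂ →
    sInf {x | ∃ t₁, IsMixed t₁ ∧ U u₂ t₁ t₂ = x} ≤
      sInf {x | ∃ t₁, IsMixed t₁ ∧ U u₂ t₁ s₂ = x}

/-- The pure (Dirac) strategy on action `a`. -/
noncomputable def pureStrat {α : Type*} [DecidableEq α] (a : α) : α → ℝ :=
  fun b => if b = a then 1 else 0

theorem U_swap {α β : Type*} [Fintype α] [Fintype β]
    (u : α → β → ℝ) (t₁ : α → ℝ) (t₂ : β → ℝ) :
    U (fun b a => u a b) t₂ t₁ = U u t₁ t₂ := by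
  unfold U
  rw [Finset.sum_comm]
  simp only [mul_comm (t₂ _)]

theorem U_neg {α β : Type*} [Fintype α] [Fintype β]
    (u : α → β → ℝ) (t₁ : α → ℝ) (t₂ : β → ℝ) :
    U (fun a b => -u a b) t₁ t₂ = -U u t₁ t₂ := by
  simp [U]

theorem isLinearMap_U_right {α β : Type*} [Fintype α] [Fintype β]
    (u : α → β → ℝ) (t₁ : α → ℝ) : IsLinearMap ℝ (U u t₁) where
  map_add x y := by
    simp only [U, Pi.add_apply, mul_add, add_mul, Finset.sum_add_distrib]
  map_smul c x := by
    simp only [U, Pi.smul_apply, smul_eq_mul, Finset.mul_sum]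
    exact Finset.sum_congr rfl fun _ _ => Finset.sum_congr rfl fun _ _ => by ring

theorem isLinearMap_U_left {α β : Type*} [Fintype α] [Fintype β]
    (u : α → β → ℝ) (t₂ : β → ℝ) : IsLinearMap ℝ (fun t₁ => U u t₁ t₂) := by
  simpa only [U_swap] using show IsLinearMap ℝ fun t₁ => U (fun b a => u a b) t₂ t₁ from
    isLinearMap_U_right (fun b a => u a b) t₂

theorem continuous_U_right {α β : Type*} [Fintype α] [Fintype β]
    (u : α → β → ℝ) (t₁ : α → ℝ) : Continuous (U u t₁) :=
  (isLinearMap_U_right u t₁).mk'.continuous_of_finiteDimensional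

theorem continuous_U_left {α β : Type*} [Fintype α] [Fintype β]
    (u : α → β → ℝ) (t₂ : β → ℝ) : Continuous (fun t₁ => U u t₁ t₂) :=
  (isLinearMap_U_left u t₂).mk'.continuous_of_finiteDimensional

/-- The minimax theorem for the mixed extension of a finite zero-sum game, in saddle point form. -/
theorem exists_saddlePoint_U {α β : Type*} [Fintype α] [Fintype β] [Nonempty α] [Nonempty β]
    (u : α → β → ℝ) :
    ∃ t₁ t₂, IsMixed t₁ ∧ IsMixed t₂ ∧
      ∀ r₁ r₂, IsMixed r₁ → IsMixed r₂ → U u r₁ t₂ ≤ U u t₁ r₂ := by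
  classical
  obtain ⟨t₂, h₂, t₁, h₁, h⟩ := Sion.exists_isSaddlePointOn
    (X := stdSimplex ℝ β) (Y := stdSimplex ℝ α) (f := fun t₂ t₁ => U u t₁ t₂)
    ⟨_, single_mem_stdSimplex ℝ (Classical.arbitrary β)⟩
    (convex_stdSimplex ℝ β) (isCompact_stdSimplex ℝ β)
    (fun t₁ _ => (continuous_U_right u t₁).lowerSemicontinuous.lowerSemicontinuousOn _)
    (fun t₁ _ => ((isLinearMap_U_right u t₁).mk'.convexOn
      (convex_stdSimplex ℝ β)).quasiconvexOn)
    (convex_stdSimplex ℝ α)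
    ⟨_, single_mem_stdSimplex ℝ (Classical.arbitrary α)⟩
    (isCompact_stdSimplex ℝ α)
    (fun t₂ _ => (continuous_U_left u t₂).upperSemicontinuous.upperSemicontinuousOn _)
    (fun t₂ _ => ((isLinearMap_U_left u t₂).mk'.concaveOn
      (convex_stdSimplex ℝ α)).quasiconcaveOn)
  exact ⟨t₁, t₂, h₁, h₂, fun r₁ r₂ hr₁ hr₂ => h r₂ hr₂ r₁ hr₁⟩

/-- A maximin strategy guarantees any payoff that some mixed strategy guarantees. -/
theorem IsMaximin1.le_U {α β : Type*} [Fintype α] [Fintype β] {u : α → β → ℝ} {s t : α → ℝ}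
    {c : ℝ} (hs : IsMaximin1 u s) (ht : IsMixed t) (hc : ∀ r, IsMixed r → c ≤ U u t r)
    {r : β → ℝ} (hr : IsMixed r) : c ≤ U u s r := by
  have hbdd : BddBelow {x | ∃ r, IsMixed r ∧ U u s r = x} :=
    ((isCompact_stdSimplex ℝ β).image (continuous_U_right u s)).bddBelow
  calc c ≤ sInf {x | ∃ r, IsMixed r ∧ U u t r = x} := by
        refine le_csInf ⟨_, r, hr, rfl⟩ ?_
        rintro _ ⟨r', hr', rfl⟩
        exact hc r' hr'
    _ ≤ sInf {x | ∃ r, IsMixed r ∧ U u s r = x} := hs.2 t ht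
    _ ≤ U u s r := csInf_le hbdd ⟨r, hr, rfl⟩

theorem IsMaximin2.swap {α β : Type*} [Fintype α] [Fintype β] {u : α → β → ℝ} {s : β → ℝ}
    (hs : IsMaximin2 u s) : IsMaximin1 (fun b a => u a b) s := by
  simpa only [IsMaximin1, IsMaximin2, U_swap] using hs

theorem IsMaximin2.le_U {α β : Type*} [Fintype α] [Fintype β] {u : α → β → ℝ} {s t : β → ℝ}
    {c : ℝ} (hs : IsMaximin2 u s) (ht : IsMixed t) (hc : ∀ r, IsMixed r → c ≤ U u r t)
    {r : α → ℝ} (hr : IsMixed r) : c ≤ U u r s := by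
  rw [← U_swap]
  exact hs.swap.le_U ht (fun r hr => by rw [U_swap]; exact hc r hr) hr

/-- In a finite two-player zero-sum game, a pair of maximin strategies is a Nash
equilibrium of the mixed extension. -/
theorem maximin_pair_is_nash_zero_sum
    {α β : Type*} [Fintype α] [Fintype β] [Nonempty α] [Nonempty β]
    (u₁ u₂ : α → β → ℝ) (hzs : ∀ a b, u₂ a b = -u₁ a b)
    (s₁ : α → ℝ) (s₂ : β → ℝ)
    (h₁ : IsMaximin1 u₁ s₁) (h₂ : IsMaximin2 u₂ s₂) :
    IsBR1 u₁ s₁ s₂ ∧ IsBR2 u₂ s₁ s₂ := by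
  obtain rfl : u₂ = fun a b => -u₁ a b := funext₂ hzs
  obtain ⟨t₁, t₂, ht₁, ht₂, h⟩ := exists_saddlePoint_U u₁
  have lower {r₂} (hr₂ : IsMixed r₂) : U u₁ t₁ t₂ ≤ U u₁ s₁ r₂ :=
    h₁.le_U ht₁ (fun r hr => h t₁ r ht₁ hr) hr₂
  have upper {r₁} (hr₁ : IsMixed r₁) : U u₁ r₁ s₂ ≤ U u₁ t₁ t₂ := by
    have := h₂.le_U (c := -U u₁ t₁ t₂) ht₂
      (fun r hr => by rw [U_neg]; exact neg_le_neg (h r t₂ hr ht₂)) hr₁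
    rwa [U_neg, neg_le_neg_iff] at this
  refine ⟨⟨h₁.1, fun r₁ hr₁ => (upper hr₁).trans (lower h₂.1)⟩, h₂.1, fun r₂ hr₂ => ?_⟩
  rw [U_neg, U_neg, neg_le_neg_iff]
  exact (upper h₁.1).trans (lower hr₂)
end

section
/- (Theorem 2: inconsistency of MARC.) Fix n ≥ 2 and consider the n-player game G_n in which every player j has action set A_j = {x_1, x_2}, players 1 and 2 have payoffs depending only on the actions (a_1, a_2) given by u_1(x_1,x_1) = 2, u_2(x_1,x_1) = 1, u_1(x_2,x_2) = 1, u_2(x_2,x_2) = 2, and u_1 = u_2 = 0 when a_1 ≠ a_2, and every player j with 3 ≤ j ≤ n has payoff u_j(a) = 1 if a_j = x_1 and u_j(a) = 0 otherwise. Then MARC fails in G_n: there is no mixed-strategy profile s = (s_1, …, s_n) such that simultaneously (i) for every player i, s_i is a best response to s_{-i}, and (ii) for every player i, s_i solves player i's Definition-4 problem. -/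
/-- Expected payoff of a mixed-strategy profile `t` under payoff function `u`. -/
noncomputable def UN {ι : Type*} [Fintype ι] [DecidableEq ι] {A : ι → Type*} [∀ i, Fintype (A i)]
    (u : (∀ i, A i) → ℝ) (t : ∀ i, A i → ℝ) : ℝ :=
  ∑ a : ∀ i, A i, (∏ i, t i (a i)) * u a

/-- `s` solves player `i`'s Definition-4 problem: player `i` is rational assuming that
every player `j ≠ i` is both rational and correct.  That is, there is a profile `t` with
`t i = s` in which every `t j` (`j ≠ i`) is a best response to `t₋ⱼ`, and `t` maximizes
player `i`'s expected payoff among all such profiles. -/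
def SolvesN {ι : Type*} [Fintype ι] [DecidableEq ι] {A : ι → Type*} [∀ i, Fintype (A i)]
    (u : ι → (∀ i, A i) → ℝ) (i : ι) (s : A i → ℝ) : Prop :=
  ∃ t : ∀ j, A j → ℝ, (∀ j, IsMixed (t j)) ∧ t i = s ∧
    (∀ j, j ≠ i → ∀ t' : A j → ℝ, IsMixed t' →
      UN (u j) (Function.update t j t') ≤ UN (u j) t) ∧
    (∀ t' : ∀ j, A j → ℝ, (∀ j, IsMixed (t' j)) →
      (∀ j, j ≠ i → ∀ t'' : A j → ℝ, IsMixed t'' →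
        UN (u j) (Function.update t' j t'') ≤ UN (u j) t') →
      UN (u i) t' ≤ UN (u i) t)

/-- Player 1's payoffs in the counterexample game of Figure 1 (`x₁ = 0`, `x₂ = 1`). -/
noncomputable def cu₁ (a b : Fin 2) : ℝ :=
  if a = 0 ∧ b = 0 then 2 else if a = 1 ∧ b = 1 then 1 else 0

/-- Player 2's payoffs in the counterexample game of Figure 1. -/
noncomputable def cu₂ (a b : Fin 2) : ℝ :=
  if a = 0 ∧ b = 0 then 1 else if a = 1 ∧ b = 1 then 2 else 0

/-- Payoffs of the `n`-player game `G_n`: players `0` and `1` play the game of Figure 1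
(their payoffs depend only on coordinates `0` and `1` of the action profile), and every
other player `j` gets payoff `1` if she plays `x₁ = 0` and `0` otherwise (so `x₁` is
strictly dominant for those players). -/
noncomputable def payoffGn (n : ℕ) (j : Fin n) (a : Fin n → Fin 2) : ℝ :=
  let a' : ℕ → Fin 2 := fun k => if h : k < n then a ⟨k, h⟩ else 0
  if (j : ℕ) = 0 then cu₁ (a' 0) (a' 1)
  else if (j : ℕ) = 1 then cu₂ (a' 0) (a' 1)
  else if a j = 0 then 1 else 0

/-- Under independent mixed strategies, the expectation of a product of functions of two different
players' actions is the product of the expectations. -/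
theorem UN_mul_eq {ι : Type*} [Fintype ι] [DecidableEq ι] {A : ι → Type*} [∀ i, Fintype (A i)]
    {t : ∀ i, A i → ℝ} (ht : ∀ k, ∑ x, t k x = 1) {i j : ι} (hij : i ≠ j)
    (φ : A i → ℝ) (ψ : A j → ℝ) :
    UN (fun a => φ (a i) * ψ (a j)) t = (∑ x, t i x * φ x) * ∑ x, t j x * ψ x := by
  let g : ∀ k, A k → ℝ := Function.update (Function.update (fun _ _ => 1) i φ) j ψ
  have gi : g i = φ := by simp [g, hij]
  have gj : g j = ψ := by simp [g]
  have g1 : ∀ k, k ≠ i ∧ k ≠ j → g k = fun _ => 1 := fun k hk => by simp [g, hk.1, hk.2]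
  have hg : ∀ a : ∀ k, A k, φ (a i) * ψ (a j) = ∏ k, g k (a k) := fun a => by
    rw [Fintype.prod_eq_mul i j hij fun k hk => by rw [g1 k hk], gi, gj]
  have hm : ∏ k, ∑ x, t k x * g k x = (∑ x, t i x * φ x) * ∑ x, t j x * ψ x := by
    rw [Fintype.prod_eq_mul i j hij fun k hk => by simp [g1 k hk, ht], gi, gj]
  rw [← hm, Fintype.prod_sum]
  simp only [UN, hg, Finset.prod_mul_distrib]

theorem UN_add {ι : Type*} [Fintype ι] [DecidableEq ι] {A : ι → Type*} [∀ i, Fintype (A i)]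
    (u v : (∀ i, A i) → ℝ) (t : ∀ i, A i → ℝ) :
    UN (fun a => u a + v a) t = UN u t + UN v t := by
  simp only [UN, mul_add, Finset.sum_add_distrib]

theorem isMixed_pureStrat {α : Type*} [Fintype α] [DecidableEq α] (a : α) :
    IsMixed (pureStrat a) :=
  ⟨fun b => by unfold pureStrat; split_ifs <;> norm_num, by simp [pureStrat]⟩

theorem IsMixed.update {ι : Type*} [DecidableEq ι] {A : ι → Type*} [∀ i, Fintype (A i)]
    {t : ∀ i, A i → ℝ} (ht : ∀ i, IsMixed (t i)) {j : ι} {r : A j → ℝ} (hr : IsMixed r) (k : ι) :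
    IsMixed (Function.update t j r k) := by
  by_cases h : k = j
  · subst h; simpa using hr
  · simpa [h] using ht k

theorem UN_payoffGn_first {n : ℕ} (hn : 2 ≤ n) {t : Fin n → Fin 2 → ℝ}
    (ht : ∀ i, IsMixed (t i)) :
    UN (payoffGn n ⟨0, by lia⟩) t =
    2 * (t ⟨0, by lia⟩ 0 * t ⟨1, by lia⟩ 0) + t ⟨0, by lia⟩ 1 * t ⟨1, by lia⟩ 1 := by
  have h : payoffGn n ⟨0, by lia⟩ = fun a =>
      2 * pureStrat (0 : Fin 2) (a ⟨0, by lia⟩) * pureStrat (0 : Fin 2) (a ⟨1, by lia⟩) +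
        pureStrat (1 : Fin 2) (a ⟨0, by lia⟩) * pureStrat (1 : Fin 2) (a ⟨1, by lia⟩) := by
    funext a
    have h0 : 0 < n := by lia
    have h1 : 1 < n := by lia
    simp only [payoffGn, h0, h1, dite_true, if_true]
    generalize a ⟨0, _⟩ = x
    generalize a ⟨1, _⟩ = y
    fin_cases x <;> fin_cases y <;> simp [cu₁, pureStrat]
  have hne : (⟨0, by lia⟩ : Fin n) ≠ ⟨1, by lia⟩ := by simp
  rw [h, UN_add, UN_mul_eq (fun k => (ht k).2) hne (fun x => 2 * pureStrat 0 x) (pureStrat 0),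
    UN_mul_eq (fun k => (ht k).2) hne (pureStrat 1) (pureStrat 1)]
  simp [pureStrat]
  ring

theorem UN_payoffGn_second {n : ℕ} (hn : 2 ≤ n) {t : Fin n → Fin 2 → ℝ}
    (ht : ∀ i, IsMixed (t i)) :
    UN (payoffGn n ⟨1, by lia⟩) t =
    t ⟨0, by lia⟩ 0 * t ⟨1, by lia⟩ 0 + 2 * (t ⟨0, by lia⟩ 1 * t ⟨1, by lia⟩ 1) := by
  have h : payoffGn n ⟨1, by lia⟩ = fun a =>
      pureStrat (0 : Fin 2) (a ⟨0, by lia⟩) * pureStrat (0 : Fin 2) (a ⟨1, by lia⟩) +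
        2 * pureStrat (1 : Fin 2) (a ⟨0, by lia⟩) * pureStrat (1 : Fin 2) (a ⟨1, by lia⟩) := by
    funext a
    have h0 : 0 < n := by lia
    have h1 : 1 < n := by lia
    simp only [payoffGn, h0, h1, dite_true, if_true, one_ne_zero, if_false]
    generalize a ⟨0, _⟩ = x
    generalize a ⟨1, _⟩ = y
    fin_cases x <;> fin_cases y <;> simp [cu₂, pureStrat]
  have hne : (⟨0, by lia⟩ : Fin n) ≠ ⟨1, by lia⟩ := by simp
  rw [h, UN_add, UN_mul_eq (fun k => (ht k).2) hne (pureStrat 0) (pureStrat 0),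
    UN_mul_eq (fun k => (ht k).2) hne (fun x => 2 * pureStrat 1 x) (pureStrat 1)]
  simp [pureStrat]
  ring

theorem UN_payoffGn_other {n : ℕ} (hn : 2 ≤ n) {t : Fin n → Fin 2 → ℝ}
    (ht : ∀ i, IsMixed (t i))
    {j : Fin n} (h0 : (j : ℕ) ≠ 0) (h1 : (j : ℕ) ≠ 1) :
    UN (payoffGn n j) t = t j 0 := by
  have h : payoffGn n j = fun a =>
      pureStrat (0 : Fin 2) (a j) * (fun _ => 1) (a ⟨0, by lia⟩) := by
    funext a
    simp [payoffGn, h0, h1, pureStrat]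
  have hne : j ≠ ⟨0, by lia⟩ := fun e => h0 (by simp [e])
  rw [h, UN_mul_eq (fun k => (ht k).2) hne (pureStrat 0) (fun _ => 1)]
  simp only [mul_one, (ht _).2]
  simp [pureStrat]

theorem IsMixed.apply_one {r : Fin 2 → ℝ} (hr : IsMixed r) : r 1 = 1 - r 0 := by
  have := hr.2
  rw [Fin.sum_univ_two] at this
  linarith

theorem IsMixed.apply_le_one {α : Type*} [Fintype α] {r : α → ℝ} (hr : IsMixed r) (a : α) :
    r a ≤ 1 :=
  hr.2 ▸ Finset.single_le_sum (fun b _ => hr.1 b) (Finset.mem_univ a)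

theorem apply_zero_eq_one_of_solvesN {n : ℕ} (hn : 2 ≤ n) {r : Fin 2 → ℝ}
    (h : SolvesN (payoffGn n) ⟨0, by lia⟩ r) : r 0 = 1 := by
  obtain ⟨t, ht, rfl, -, hmax⟩ := h
  have hm : ∀ k : Fin n, IsMixed ((fun _ => pureStrat 0 : Fin n → Fin 2 → ℝ) k) :=
    fun _ => isMixed_pureStrat 0
  have key := hmax _ hm fun j hj r hr => by
    have hu := IsMixed.update hm (j := j) hr
    have h0 : (j : ℕ) ≠ 0 := fun e => hj (Fin.ext e)
    by_cases h1 : (j : ℕ) = 1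
    · obtain rfl : j = ⟨1, by lia⟩ := Fin.ext h1
      rw [UN_payoffGn_second hn hu, UN_payoffGn_second hn hm]
      simpa [pureStrat] using hr.apply_le_one 0
    · rw [UN_payoffGn_other hn hu h0 h1, UN_payoffGn_other hn hm h0 h1]
      simpa [pureStrat] using hr.apply_le_one 0
  rw [UN_payoffGn_first hn hm, UN_payoffGn_first hn ht, (ht _).apply_one,
    (ht ⟨1, _⟩).apply_one] at key
  simp only [pureStrat] at key
  norm_num at key
  have hp := (ht ⟨0, by lia⟩).apply_le_one 0
  have hp' := (ht ⟨0, by lia⟩).1 0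
  have hq := (ht ⟨1, by lia⟩).apply_le_one 0
  have hq' := (ht ⟨1, by lia⟩).1 0
  nlinarith [mul_nonneg hp' (sub_nonneg.2 hq), mul_nonneg (sub_nonneg.2 hp) (sub_nonneg.2 hq),
    mul_nonneg (sub_nonneg.2 hp) hq']

theorem apply_one_eq_one_of_solvesN {n : ℕ} (hn : 2 ≤ n) {r : Fin 2 → ℝ}
    (h : SolvesN (payoffGn n) ⟨1, by lia⟩ r) : r 1 = 1 := by
  obtain ⟨t, ht, rfl, -, hmax⟩ := h
  have hm : ∀ k : Fin n,
      IsMixed ((fun k => pureStrat (if (k : ℕ) ≤ 1 then 1 else 0) : Fin n → Fin 2 → ℝ) k) :=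
    fun _ => isMixed_pureStrat _
  have key := hmax _ hm fun j hj r hr => by
    have hu := IsMixed.update hm (j := j) hr
    have h1 : (j : ℕ) ≠ 1 := fun e => hj (Fin.ext e)
    by_cases h0 : (j : ℕ) = 0
    · obtain rfl : j = ⟨0, by lia⟩ := Fin.ext h0
      rw [UN_payoffGn_first hn hu, UN_payoffGn_first hn hm]
      simpa [pureStrat] using hr.apply_le_one 1
    · rw [UN_payoffGn_other hn hu h0 h1, UN_payoffGn_other hn hm h0 h1]
      have hj' : ¬ (j : ℕ) ≤ 1 := by lia
      simpa [pureStrat, hj'] using hr.apply_le_one 0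
  rw [UN_payoffGn_second hn hm, UN_payoffGn_second hn ht, (ht _).apply_one,
    (ht ⟨1, _⟩).apply_one] at key
  rw [(ht _).apply_one]
  simp only [pureStrat] at key
  norm_num at key
  have hp := (ht ⟨0, by lia⟩).apply_le_one 0
  have hp' := (ht ⟨0, by lia⟩).1 0
  have hq := (ht ⟨1, by lia⟩).apply_le_one 0
  have hq' := (ht ⟨1, by lia⟩).1 0
  nlinarith [mul_nonneg hp' (sub_nonneg.2 hq), mul_nonneg (sub_nonneg.2 hp) hq',
    mul_nonneg hp' hq']

/-- Theorem 2 (Inconsistency): MARC fails in the `n`-player game `G_n` for every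
`n ≥ 2`: there is no mixed-strategy profile `s` such that every `s i` is a best
response to `s₋ᵢ` and every `s i` solves player `i`'s Definition-4 problem. -/
theorem marc_fails_Gn (n : ℕ) (hn : 2 ≤ n) :
    ¬ ∃ s : ∀ _ : Fin n, Fin 2 → ℝ, (∀ i, IsMixed (s i)) ∧
        (∀ i, ∀ t' : Fin 2 → ℝ, IsMixed t' →
          UN (payoffGn n i) (Function.update s i t') ≤ UN (payoffGn n i) s) ∧
        (∀ i, SolvesN (payoffGn n) i (s i)) := by
  rintro ⟨s, hs, hbr, hsol⟩
  have p0 := apply_zero_eq_one_of_solvesN hn (hsol ⟨0, by lia⟩)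
  have q1 := apply_one_eq_one_of_solvesN hn (hsol ⟨1, by lia⟩)
  have hp := (hs ⟨0, by lia⟩).2
  have hq := (hs ⟨1, by lia⟩).2
  have h := hbr ⟨0, by lia⟩ (pureStrat 1) (isMixed_pureStrat 1)
  rw [UN_payoffGn_first hn (IsMixed.update hs (isMixed_pureStrat 1)),
    UN_payoffGn_first hn hs] at h
  rw [Fin.sum_univ_two] at hp hq
  have p1 : s ⟨0, by lia⟩ 1 = 0 := by linarith
  have q0 : s ⟨1, by lia⟩ 0 = 0 := by linarith
  simp [pureStrat, p0, p1, q0, q1] at h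
  linarith
end
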